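/- Let n ≥ 5 and n/(n-4) < p < (n+4)/(n-4), and let u be a nonnegative C⁴ solution of Δ²u = u^p in the punctured ball B₁\{0} ⊂ ℝⁿ. If lim_{|x|→0} |x|^{4/(p-1)} u(x) = 0, then ∫_{{0<|x|≤1/2}} u(x)^{(p-1)n/4} dx < +∞. -/

import Mathlib

open MeasureTheory Metric Filter

/-- The Euclidean Laplacian `Δu` of `u : ℝⁿ → ℝ`, computed as the trace of the second
derivative: `Δu(x) = ∑ i, ∂²u/∂xᵢ²(x)`. -/
noncomputable def lap {n : ℕ} (u : EuclideanSpace ℝ (Fin n) → ℝ) :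
    EuclideanSpace ℝ (Fin n) → ℝ :=
  fun x => ∑ i : Fin n,
    iteratedFDeriv ℝ 2 u x ![EuclideanSpace.single i 1, EuclideanSpace.single i 1]

/-- The biharmonic operator `Δ²u = Δ(Δu)`. -/
noncomputable def bilap {n : ℕ} (u : EuclideanSpace ℝ (Fin n) → ℝ) :
    EuclideanSpace ℝ (Fin n) → ℝ :=
  lap (lap u)

section Laplacian

variable {n : ℕ} {f g : EuclideanSpace ℝ (Fin n) → ℝ} {x : EuclideanSpace ℝ (Fin n)}

open Topology in
lemma lap_congr_nhds (h : f =ᶠ[𝓝 x] g) : lap f =ᶠ[𝓝 x] lap g := by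
  filter_upwards [EventuallyEq.iteratedFDeriv ℝ h 2] with y hy
  simp [lap, hy]

open Topology in
lemma bilap_congr_nhds (h : f =ᶠ[𝓝 x] g) : bilap f x = bilap g x :=
  (lap_congr_nhds (lap_congr_nhds h)).eq_of_nhds

lemma lap_sub (hf : ContDiff ℝ 2 f) (hg : ContDiff ℝ 2 g) :
    lap (fun y => f y - g y) = fun y => lap f y - lap g y := by
  funext x
  have := iteratedFDeriv_sub_apply (x := x) hf.contDiffAt hg.contDiffAt
  change iteratedFDeriv ℝ 2 (fun y => f y - g y) x = _ at this
  simp [lap, this, Finset.sum_sub_distrib]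

lemma lap_const_mul (a : ℝ) (hf : ContDiff ℝ 2 f) :
    lap (fun y => a * f y) = fun y => a * lap f y := by
  funext x
  have := iteratedFDeriv_const_smul_apply (a := a) (x := x) hf.contDiffAt
  change iteratedFDeriv ℝ 2 (fun y => a * f y) x = _ at this
  simp [lap, this, Finset.mul_sum]

lemma lap_comp_smul (b : ℝ) (hf : ContDiff ℝ 2 f) :
    lap (fun y => f (b • y)) = fun y => b ^ 2 * lap f (b • y) := by
  funext x
  have := congrFun (iteratedFDeriv_comp_const_smul (i := 2) b hf) x
  simp [lap, this, Finset.mul_sum]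

lemma fderiv_apply_const_apply {m : WithTop ℕ∞} (hf : ContDiff ℝ (m + 1) f)
    (v : EuclideanSpace ℝ (Fin n)) : ContDiff ℝ m (fun y => fderiv ℝ f y v) :=
  (hf.fderiv_right le_rfl).clm_apply contDiff_const

lemma lap_eq_sum_fderiv (hf : ContDiffAt ℝ 2 f x) :
    lap f x = ∑ i, fderiv ℝ (fun y => fderiv ℝ f y (EuclideanSpace.single i 1)) x
      (EuclideanSpace.single i 1) := by
  have hd : DifferentiableAt ℝ (fderiv ℝ f) x :=
    (hf.fderiv_right (m := 1) (by norm_num)).differentiableAt (by norm_num)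
  refine Finset.sum_congr rfl fun i _ => ?_
  rw [iteratedFDeriv_two_apply, fderiv_clm_apply hd (differentiableAt_const _)]
  simp

lemma ContDiff.lap {m k : WithTop ℕ∞} (hf : ContDiff ℝ k f) (h : m + 2 ≤ k) :
    ContDiff ℝ m (lap f) := by
  unfold _root_.lap
  refine ContDiff.sum fun i _ => ?_
  have h1 : ContDiff ℝ m (iteratedFDeriv ℝ 2 f) := hf.iteratedFDeriv_right (by exact_mod_cast h)
  exact (ContinuousMultilinearMap.apply ℝ (fun _ : Fin 2 => EuclideanSpace ℝ (Fin n)) ℝ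
    ![EuclideanSpace.single i 1, EuclideanSpace.single i 1]).contDiff.comp h1

lemma HasCompactSupport.lap (hf : HasCompactSupport f) : HasCompactSupport (lap f) := by
  refine (hf.iteratedFDeriv (𝕜 := ℝ) 2).mono fun y hy h0 => hy ?_
  simp [_root_.lap, h0]

lemma integral_mul_lap (hf : ContDiff ℝ 2 f) (hg : ContDiff ℝ 2 g) (hc : HasCompactSupport g) :
    ∫ y, f y * lap g y = ∫ y, lap f y * g y := by
  have int : ∀ {a b : EuclideanSpace ℝ (Fin n) → ℝ}, Continuous a → Continuous b →
      HasCompactSupport b → Integrable (fun y => a y * b y) := fun ha hb hcb =>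
    (ha.mul hb).integrable_of_hasCompactSupport hcb.mul_left
  have d1 : ∀ {h : EuclideanSpace ℝ (Fin n) → ℝ} (v : EuclideanSpace ℝ (Fin n)), ContDiff ℝ 2 h →
      ContDiff ℝ 1 (fun y => fderiv ℝ h y v) := fun v hh =>
    fderiv_apply_const_apply (by norm_num; exact hh) v
  have d2 : ∀ {h : EuclideanSpace ℝ (Fin n) → ℝ} (v : EuclideanSpace ℝ (Fin n)), ContDiff ℝ 1 h →
      Continuous (fun y => fderiv ℝ h y v) := fun v hh =>
    (fderiv_apply_const_apply (m := 0) (by norm_num; exact hh) v).continuous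
  have s1 : ∀ {h : EuclideanSpace ℝ (Fin n) → ℝ} (v : EuclideanSpace ℝ (Fin n)),
      HasCompactSupport h → HasCompactSupport (fun y => fderiv ℝ h y v) := fun v hh =>
    hh.fderiv_apply (𝕜 := ℝ) v
  simp_rw [lap_eq_sum_fderiv hf.contDiffAt, lap_eq_sum_fderiv hg.contDiffAt, Finset.mul_sum,
    Finset.sum_mul]
  rw [integral_finsetSum, integral_finsetSum]
  · refine Finset.sum_congr rfl fun i _ => ?_
    set v : EuclideanSpace ℝ (Fin n) := EuclideanSpace.single i 1
    have hf1 : ContDiff ℝ 1 f := hf.of_le (by norm_num)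
    have hg1 : ContDiff ℝ 1 g := hg.of_le (by norm_num)
    rw [integral_mul_fderiv_eq_neg_fderiv_mul_of_integrable,
      integral_mul_fderiv_eq_neg_fderiv_mul_of_integrable, neg_neg]
    · exact int (d2 v (d1 v hf)) hg.continuous hc
    · exact int (d1 v hf).continuous (d1 v hg).continuous (s1 v hc)
    · exact int (d1 v hf).continuous hg.continuous hc
    · exact fun y _ => ((d1 v hf).differentiable (by norm_num)) y
    · exact fun y _ => (hg.differentiable (by norm_num)) y
    · exact int (d1 v hf).continuous (d1 v hg).continuous (s1 v hc)
    · exact int hf.continuous (d2 v (d1 v hg)) (s1 v (s1 v hc))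
    · exact int hf.continuous (d1 v hg).continuous (s1 v hc)
    · exact fun y _ => (hf.differentiable (by norm_num)) y
    · exact fun y _ => ((d1 v hg).differentiable (by norm_num)) y
  · exact fun i _ => int (d2 _ (d1 _ hf)) hg.continuous hc
  · exact fun i _ => int hf.continuous (d2 _ (d1 _ hg)) (s1 _ (s1 _ hc))

lemma integral_mul_bilap (hf : ContDiff ℝ 4 f) (hg : ContDiff ℝ 4 g) (hc : HasCompactSupport g) :
    ∫ y, f y * bilap g y = ∫ y, bilap f y * g y := by
  have hf2 : ContDiff ℝ 2 (lap f) := hf.lap (by norm_num)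
  have hg2 : ContDiff ℝ 2 (lap g) := hg.lap (by norm_num)
  unfold bilap
  rw [integral_mul_lap (hf.of_le (by norm_num)) hg2 hc.lap,
    integral_mul_lap hf2 (hg.of_le (by norm_num)) hc]

lemma hasFDerivAt_norm_rpow_of_ne_zero (s : ℝ) (hx : x ≠ 0) :
    HasFDerivAt (fun y : EuclideanSpace ℝ (Fin n) => ‖y‖ ^ s)
      ((s * ‖x‖ ^ (s - 2)) • innerSL ℝ x) x := by
  have h1 := (hasStrictFDerivAt_norm_sq x).hasFDerivAt
  have hpos : 0 < ‖x‖ := norm_pos_iff.mpr hx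
  have h2 := h1.rpow_const (p := s / 2) (Or.inl (by positivity))
  have e : ∀ y : EuclideanSpace ℝ (Fin n), ∀ t : ℝ, (‖y‖ ^ 2) ^ (t / 2) = ‖y‖ ^ t := by
    intro y t
    rw [← Real.rpow_natCast, ← Real.rpow_mul (norm_nonneg _)]
    congr 1; push_cast; ring
  have e2 : s / 2 - 1 = (s - 2) / 2 := by ring
  simp only [e2, e] at h2
  refine h2.congr_fderiv ?_
  ext v
  simp
  ring

lemma contDiffAt_norm_rpow (s : ℝ) (hx : x ≠ 0) {m : WithTop ℕ∞} :
    ContDiffAt ℝ m (fun y : EuclideanSpace ℝ (Fin n) => ‖y‖ ^ s) x :=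
  (contDiffAt_norm ℝ hx).rpow_const_of_ne (norm_ne_zero_iff.mpr hx)

lemma lap_norm_rpow (s : ℝ) (hx : x ≠ 0) :
    lap (fun y : EuclideanSpace ℝ (Fin n) => ‖y‖ ^ s) x = s * (s + n - 2) * ‖x‖ ^ (s - 2) := by
  rw [lap_eq_sum_fderiv (contDiffAt_norm_rpow s hx)]
  have key : ∀ i : Fin n, fderiv ℝ (fun y => fderiv ℝ
      (fun z : EuclideanSpace ℝ (Fin n) => ‖z‖ ^ s) y (EuclideanSpace.single i 1)) x
      (EuclideanSpace.single i 1)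
      = s * ((s - 2) * ‖x‖ ^ (s - 4)) * x i ^ 2 + s * ‖x‖ ^ (s - 2) := by
    intro i
    have h1 : (fun y => fderiv ℝ (fun z : EuclideanSpace ℝ (Fin n) => ‖z‖ ^ s) y
        (EuclideanSpace.single i 1)) =ᶠ[nhds x] fun y => (s * ‖y‖ ^ (s - 2)) * y i := by
      filter_upwards [isOpen_ne.mem_nhds hx] with y hy
      rw [(hasFDerivAt_norm_rpow_of_ne_zero s hy).fderiv]
      simp [EuclideanSpace.inner_single_right]
    rw [h1.fderiv_eq]
    have h2 := ((hasFDerivAt_norm_rpow_of_ne_zero (s - 2) hx).const_mul s).mul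
      (EuclideanSpace.proj (𝕜 := ℝ) i : EuclideanSpace ℝ (Fin n) →L[ℝ] ℝ).hasFDerivAt
    have h3 : HasFDerivAt (fun y : EuclideanSpace ℝ (Fin n) => (s * ‖y‖ ^ (s - 2)) * y i) _ x := h2
    rw [h3.fderiv]
    have e4 : s - 2 - 2 = s - 4 := by ring
    simp [EuclideanSpace.inner_single_right, e4]
    ring
  rw [Finset.sum_congr rfl fun i _ => key i, Finset.sum_add_distrib, ← Finset.mul_sum]
  have hpos : 0 < ‖x‖ := norm_pos_iff.mpr hx
  have hn : ∑ i, x i ^ 2 = ‖x‖ ^ 2 := by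
    rw [EuclideanSpace.norm_sq_eq]; simp
  have e5 : ‖x‖ ^ (s - 4) * ‖x‖ ^ 2 = ‖x‖ ^ (s - 2) := by
    rw [← Real.rpow_natCast, ← Real.rpow_add hpos]; congr 1; push_cast; ring
  rw [hn]
  simp only [Finset.sum_const, Finset.card_univ, Fintype.card_fin, nsmul_eq_mul]
  linear_combination s * (s - 2) * e5

lemma bilap_norm_rpow (s : ℝ) (hx : x ≠ 0) :
    bilap (fun y : EuclideanSpace ℝ (Fin n) => ‖y‖ ^ s) x
      = s * (s + n - 2) * ((s - 2) * (s + n - 4)) * ‖x‖ ^ (s - 4) := by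
  have h1 : lap (fun y : EuclideanSpace ℝ (Fin n) => ‖y‖ ^ s) =ᶠ[nhds x]
      fun y => (s * (s + n - 2)) * ‖y‖ ^ (s - 2) := by
    filter_upwards [isOpen_ne.mem_nhds hx] with y hy using lap_norm_rpow s hy
  have h2 := (lap_congr_nhds h1).eq_of_nhds
  have h3 : lap (fun y : EuclideanSpace ℝ (Fin n) => (s * (s + n - 2)) * ‖y‖ ^ (s - 2)) x
      = (s * (s + n - 2)) * lap (fun y => ‖y‖ ^ (s - 2)) x := by
    have := iteratedFDeriv_const_smul_apply (a := s * (s + n - 2)) (i := 2)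
      (contDiffAt_norm_rpow (s - 2) hx)
    change iteratedFDeriv ℝ 2 (fun y : EuclideanSpace ℝ (Fin n) =>
      (s * (s + n - 2)) * ‖y‖ ^ (s - 2)) x = _ at this
    simp [lap, this, Finset.mul_sum]
  unfold bilap
  rw [h2, h3, lap_norm_rpow _ hx]
  have e4 : s - 2 - 2 = s - 4 := by ring
  rw [e4]; ring

end Laplacian

section Annulus

variable {n : ℕ}

lemma tsupport_lap_subset {f : EuclideanSpace ℝ (Fin n) → ℝ} : tsupport (lap f) ⊆ tsupport f := by
  refine closure_minimal (fun y hy => ?_) (isClosed_tsupport f)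
  refine tsupport_iteratedFDeriv_subset (𝕜 := ℝ) 2 (subset_tsupport _ fun h0 => hy ?_)
  simp [lap, h0]

lemma tsupport_bilap_subset {f : EuclideanSpace ℝ (Fin n) → ℝ} :
    tsupport (bilap f) ⊆ tsupport f :=
  tsupport_lap_subset.trans tsupport_lap_subset

open Manifold in
/-- Green's second identity for the biharmonic operator, for a function that is only regular on an
open set containing the support of the test function. -/
lemma ContDiffOn.integral_mul_bilap {u φ : EuclideanSpace ℝ (Fin n) → ℝ}
    {U : Set (EuclideanSpace ℝ (Fin n))} (hU : IsOpen U) (hu : ContDiffOn ℝ 4 u U)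
    (hφ : ContDiff ℝ 4 φ) (hc : HasCompactSupport φ) (hsub : tsupport φ ⊆ U) :
    Integrable (fun x => u x * bilap φ x) ∧ Integrable (fun x => bilap u x * φ x) ∧
      ∫ x, u x * bilap φ x = ∫ x, bilap u x * φ x := by
  obtain ⟨L, hL, hKL, hLU⟩ := exists_compact_between hc hU hsub
  obtain ⟨κ, hκ1, hκ0, -⟩ := exists_contMDiffMap_one_nhds_of_subset_interior (n := 4)
    𝓘(ℝ, EuclideanSpace ℝ (Fin n)) (isClosed_tsupport φ) hKL
  have hκ : ContDiff ℝ 4 κ := κ.contMDiff.contDiff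
  set v : EuclideanSpace ℝ (Fin n) → ℝ := fun x => κ x * u x with hv
  have hvC : ContDiff ℝ 4 v := by
    rw [contDiff_iff_contDiffAt]
    intro x
    by_cases hx : x ∈ L
    · exact hκ.contDiffAt.mul (hu.contDiffAt (hU.mem_nhds (hLU hx)))
    · refine (contDiffAt_const (c := (0 : ℝ))).congr_of_eventuallyEq ?_
      filter_upwards [hL.isClosed.isOpen_compl.mem_nhds hx] with y hy
      simp [hv, hκ0 y hy]
  have hloc : ∀ x ∈ tsupport φ, v =ᶠ[nhds x] u := by
    intro x hx
    filter_upwards [eventually_nhdsSet_iff_forall.mp hκ1 x hx] with y hy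
    simp [hv, hy]
  have e1 : (fun x => u x * bilap φ x) = fun x => v x * bilap φ x := by
    funext x
    by_cases hx : x ∈ tsupport φ
    · rw [(hloc x hx).eq_of_nhds]
    · have : bilap φ x = 0 := image_eq_zero_of_notMem_tsupport fun h => hx (tsupport_bilap_subset h)
      simp [this]
  have e2 : (fun x => bilap u x * φ x) = fun x => bilap v x * φ x := by
    funext x
    by_cases hx : x ∈ tsupport φ
    · rw [bilap_congr_nhds (hloc x hx)]
    · simp [image_eq_zero_of_notMem_tsupport hx]
  have hφ2 : ContDiff ℝ 2 (lap φ) := hφ.lap (by norm_num)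
  have hv2 : ContDiff ℝ 2 (lap v) := hvC.lap (by norm_num)
  have cφ : Continuous (bilap φ) := (hφ2.lap (m := 0) (by norm_num)).continuous
  have cv : Continuous (bilap v) := (hv2.lap (m := 0) (by norm_num)).continuous
  rw [e1, e2]
  have hcb : HasCompactSupport (bilap φ) := hc.lap.lap
  exact ⟨(hvC.continuous.mul cφ).integrable_of_hasCompactSupport hcb.mul_left,
    (cv.mul hφ.continuous).integrable_of_hasCompactSupport hc.mul_left,
    _root_.integral_mul_bilap hvC hφ hc⟩

/-- A smooth function equal to `‖y‖ ^ s` away from the origin and vanishing near the origin. -/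
lemma exists_truncated_norm_rpow (n : ℕ) (s : ℝ) :
    ∃ g : EuclideanSpace ℝ (Fin n) → ℝ, ContDiff ℝ 4 g ∧ (∀ y, 0 ≤ g y) ∧
      (∀ y, ‖y‖ ≤ 1 → g y = 0) ∧ (∀ y, 2 ≤ ‖y‖ → g y = ‖y‖ ^ s) ∧ ∀ y, g y ≤ ‖y‖ ^ s := by
  let ψ : ContDiffBump (0 : EuclideanSpace ℝ (Fin n)) := ⟨1, 2, one_pos, one_lt_two⟩
  refine ⟨fun y => ‖y‖ ^ s * (1 - ψ y), ?_, ?_, ?_, ?_, ?_⟩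
  · rw [contDiff_iff_contDiffAt]
    intro x
    by_cases hx : x = 0
    · subst hx
      refine (contDiffAt_const (c := (0 : ℝ))).congr_of_eventuallyEq ?_
      filter_upwards [ψ.eventuallyEq_one] with y hy
      simp [hy]
    · exact (contDiffAt_norm_rpow s hx).mul (contDiffAt_const.sub ψ.contDiffAt)
  · exact fun y => mul_nonneg (by positivity) (sub_nonneg.mpr ψ.le_one)
  · intro y hy
    have : ψ y = 1 := ψ.one_of_mem_closedBall (by simpa [ψ] using hy)
    simp [this]
  · intro y hy
    have : ψ y = 0 := ψ.zero_of_le_dist (by simpa [ψ] using hy)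
    simp [this]
  · intro y
    have h1 : 0 ≤ ψ y := ψ.nonneg
    have h2 : 0 ≤ ‖y‖ ^ s := by positivity
    change ‖y‖ ^ s * (1 - ψ y) ≤ ‖y‖ ^ s
    nlinarith [mul_nonneg h2 h1]

lemma bilap_rescale_sub {g : EuclideanSpace ℝ (Fin n) → ℝ} (hg : ContDiff ℝ 4 g) (a b a' b' : ℝ)
    (x : EuclideanSpace ℝ (Fin n)) :
    bilap (fun y => a * g (b • y) - a' * g (b' • y)) x
      = a * b ^ 4 * bilap g (b • x) - a' * b' ^ 4 * bilap g (b' • x) := by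
  have hg2 : ContDiff ℝ 2 g := hg.of_le (by norm_num)
  have hl2 : ContDiff ℝ 2 (lap g) := hg.lap (by norm_num)
  have c : ∀ {h : EuclideanSpace ℝ (Fin n) → ℝ} (a b : ℝ), ContDiff ℝ 2 h →
      ContDiff ℝ 2 (fun y => a * h (b • y)) := fun a b hh =>
    contDiff_const.mul (hh.comp (contDiff_const_smul b))
  have c' : ∀ {h : EuclideanSpace ℝ (Fin n) → ℝ} (b : ℝ), ContDiff ℝ 2 h →
      ContDiff ℝ 2 (fun y => h (b • y)) := fun b hh => hh.comp (contDiff_const_smul b)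
  unfold bilap
  rw [lap_sub (c _ _ hg2) (c _ _ hg2), lap_const_mul _ (c' _ hg2), lap_const_mul _ (c' _ hg2),
    lap_comp_smul _ hg2, lap_comp_smul _ hg2]
  simp only [← mul_assoc]
  rw [lap_sub (c _ _ hl2) (c _ _ hl2), lap_const_mul _ (c' _ hl2), lap_const_mul _ (c' _ hl2),
    lap_comp_smul _ hl2, lap_comp_smul _ hl2]
  ring

/-- A test function supported in the annulus `r ≤ ‖x‖ ≤ 2δ` which behaves like `‖x‖ ^ s`, with
bounds on its bilaplacian that are uniform in `r`. -/
lemma exists_annular_test_function (n : ℕ) (s : ℝ) {δ : ℝ} (hδ : 0 < δ) :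
    ∃ C : ℝ, 0 ≤ C ∧ ∀ r : ℝ, 0 < r → 2 * r ≤ δ →
      ∃ φ : EuclideanSpace ℝ (Fin n) → ℝ, ContDiff ℝ 4 φ ∧
        (∀ x, ‖x‖ ≤ r → φ x = 0) ∧ (∀ x, 2 * δ ≤ ‖x‖ → φ x = 0) ∧
        (∀ x, 0 ≤ φ x) ∧ (∀ x, φ x ≤ ‖x‖ ^ s) ∧
        (∀ x, ‖x‖ ≤ 2 * r → -(C * r ^ (s - 4)) - C ≤ bilap φ x) ∧
        ∀ x, 2 * r < ‖x‖ → ‖x‖ ≤ 2 * δ →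
          s * (s + n - 2) * ((s - 2) * (s + n - 4)) * ‖x‖ ^ (s - 4) - C ≤ bilap φ x := by
  obtain ⟨g, hg, g0, g1, g2, gle⟩ := exists_truncated_norm_rpow n s
  have hg2 : ContDiff ℝ 2 (lap g) := hg.lap (by norm_num)
  have cg : Continuous (bilap g) := (hg2.lap (m := 0) (by norm_num)).continuous
  obtain ⟨C₀, hC₀⟩ :=
    (isCompact_closedBall (0 : EuclideanSpace ℝ (Fin n)) 2).exists_bound_of_continuousOn
      cg.continuousOn
  have hB : ∀ y : EuclideanSpace ℝ (Fin n), ‖y‖ ≤ 2 → |bilap g y| ≤ |C₀| := fun y hy =>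
    (hC₀ y (by simpa using hy)).trans (le_abs_self _)
  have hout : ∀ y : EuclideanSpace ℝ (Fin n), 2 < ‖y‖ →
      bilap g y = s * (s + n - 2) * ((s - 2) * (s + n - 4)) * ‖y‖ ^ (s - 4) := by
    intro y hy
    have hev : g =ᶠ[nhds y] fun z => ‖z‖ ^ s := by
      filter_upwards [(isOpen_lt continuous_const continuous_norm).mem_nhds hy] with z hz
      exact g2 z (le_of_lt hz)
    rw [bilap_congr_nhds hev, bilap_norm_rpow]
    rintro rfl
    simp at hy
    linarith
  have nsm : ∀ {r : ℝ}, 0 < r → ∀ x : EuclideanSpace ℝ (Fin n), ‖r⁻¹ • x‖ = r⁻¹ * ‖x‖ :=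
    fun hr x => by rw [norm_smul, Real.norm_of_nonneg (inv_nonneg.mpr hr.le)]
  have hscale : ∀ {r : ℝ}, 0 < r → ∀ (t : ℝ) (x : EuclideanSpace ℝ (Fin n)),
      r ^ t * ‖r⁻¹ • x‖ ^ t = ‖x‖ ^ t := by
    intro r hr t x
    rw [nsm hr, ← Real.mul_rpow hr.le (by positivity), mul_inv_cancel_left₀ hr.ne']
  have hpow : ∀ {r : ℝ}, 0 < r → r ^ s * r⁻¹ ^ 4 = r ^ (s - 4) := by
    intro r hr
    rw [Real.rpow_sub hr, div_eq_mul_inv, inv_pow]; norm_cast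
  have nle : ∀ {r : ℝ}, 0 < r → ∀ (k : ℝ) (x : EuclideanSpace ℝ (Fin n)),
      ‖r⁻¹ • x‖ ≤ k ↔ ‖x‖ ≤ k * r := by
    intro r hr k x
    rw [nsm hr, inv_mul_le_iff₀ hr, mul_comm]
  have nge : ∀ {r : ℝ}, 0 < r → ∀ (k : ℝ) (x : EuclideanSpace ℝ (Fin n)),
      k ≤ ‖r⁻¹ • x‖ ↔ k * r ≤ ‖x‖ := by
    intro r hr k x
    rw [nsm hr, le_inv_mul_iff₀ hr, mul_comm]
  have gles : ∀ {r : ℝ}, 0 < r → ∀ x, r ^ s * g (r⁻¹ • x) ≤ ‖x‖ ^ s := fun hr x => by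
    rw [← hscale hr s x]
    exact mul_le_mul_of_nonneg_left (gle _) (by positivity)
  refine ⟨|C₀| + |C₀| * δ ^ (s - 4), by positivity, fun r hr hrδ => ?_⟩
  have geqr : ∀ x, 2 * r ≤ ‖x‖ → r ^ s * g (r⁻¹ • x) = ‖x‖ ^ s := fun x hx => by
    rw [g2 _ ((nge hr 2 x).mpr hx), hscale hr]
  refine ⟨fun x => r ^ s * g (r⁻¹ • x) - δ ^ s * g (δ⁻¹ • x), ?_, ?_, ?_, ?_, ?_, ?_, ?_⟩
  · exact (contDiff_const.mul (hg.comp (contDiff_const_smul _))).sub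
      (contDiff_const.mul (hg.comp (contDiff_const_smul _)))
  · intro x hx
    simp only
    rw [g1 _ ((nle hr 1 x).mpr (by linarith)), g1 _ ((nle hδ 1 x).mpr (by linarith))]
    simp
  · intro x hx
    simp only
    rw [geqr x (by linarith), g2 _ ((nge hδ 2 x).mpr hx), hscale hδ, sub_self]
  · intro x
    simp only
    rcases le_total ‖x‖ δ with h | h
    · rw [g1 _ ((nle hδ 1 x).mpr (by linarith)), mul_zero, sub_zero]
      exact mul_nonneg (by positivity) (g0 _)
    · rw [geqr x (by linarith)]
      linarith [gles hδ x]
  · intro x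
    have : 0 ≤ δ ^ s * g (δ⁻¹ • x) := mul_nonneg (by positivity) (g0 _)
    simp only
    linarith [gles hr x]
  · intro x hx
    rw [bilap_rescale_sub hg, hpow hr, hpow hδ]
    have b1 := (abs_le.mp (hB _ ((nle hr 2 x).mpr hx))).1
    have b2 := (abs_le.mp (hB _ ((nle hδ 2 x).mpr (by linarith)))).2
    have p1 : 0 < r ^ (s - 4) := by positivity
    have p2 : 0 < δ ^ (s - 4) := by positivity
    have m1 := mul_le_mul_of_nonneg_left b1 p1.le
    have m2 := mul_le_mul_of_nonneg_left b2 p2.le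
    have m3 : 0 ≤ |C₀| * δ ^ (s - 4) * r ^ (s - 4) := by positivity
    have m4 := abs_nonneg C₀
    linarith
  · intro x hx hx2
    rw [bilap_rescale_sub hg, hpow hr, hpow hδ]
    have h2 : 2 < ‖r⁻¹ • x‖ := by
      rw [nsm hr, lt_inv_mul_iff₀ hr]; linarith
    have b2 := (abs_le.mp (hB _ ((nle hδ 2 x).mpr hx2))).2
    have p2 : 0 < δ ^ (s - 4) := by positivity
    have m2 := mul_le_mul_of_nonneg_left b2 p2.le
    have m4 := abs_nonneg C₀
    have e : r ^ (s - 4) * bilap g (r⁻¹ • x)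
        = s * (s + n - 2) * ((s - 2) * (s + n - 4)) * ‖x‖ ^ (s - 4) := by
      rw [hout _ h2, ← hscale hr (s - 4) x]; ring
    rw [e]
    linarith

/-- Uniform bound for the weighted integrals over annuli shrinking to the punctured ball. -/
lemma exists_bound_setIntegral_annulus {α δ : ℝ} (hα : 0 < α) (hαn : α < n - 4) (hδ : 0 < δ)
    (hδ1 : 2 * δ < 1) {u : EuclideanSpace ℝ (Fin n) → ℝ}
    (hu : ContDiffOn ℝ 4 u (ball 0 1 \ {0}))
    (hu0 : ∀ x, 0 < ‖x‖ → ‖x‖ ≤ 2 * δ → 0 ≤ u x)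
    (hu1 : ∀ x, 0 < ‖x‖ → ‖x‖ ≤ 2 * δ → u x ≤ ‖x‖ ^ (-α))
    (hu2 : ∀ x, 0 < ‖x‖ → ‖x‖ ≤ 2 * δ →
      bilap u x ≤ (n - 4 - α) * (α + 2) * ((n - 2 - α) * α) / 2 * ‖x‖ ^ (-4 : ℝ) * u x) :
    ∃ I : ℝ, ∀ r : ℝ, 0 < r → 2 * r ≤ δ →
      IntegrableOn (fun x => u x * ‖x‖ ^ (α - n)) {x | 2 * r < ‖x‖ ∧ ‖x‖ ≤ 2 * δ} ∧
      ∫ x in {x | 2 * r < ‖x‖ ∧ ‖x‖ ≤ 2 * δ}, u x * ‖x‖ ^ (α - n) ≤ I := by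
  set c : ℝ := (n - 4 - α) * (α + 2) * ((n - 2 - α) * α) with hc
  have hcpos : 0 < c := by
    refine mul_pos (mul_pos (by linarith) (by linarith)) (mul_pos (by linarith) hα)
  obtain ⟨C, hC, hφ⟩ := exists_annular_test_function n (α + 4 - n) hδ
  have es : α + 4 - n - 4 = α - (n : ℝ) := by ring
  have ec : (α + 4 - n) * (α + 4 - n + n - 2) * ((α + 4 - n - 2) * (α + 4 - n + n - 4)) = c := by
    rw [hc]; ring
  simp only [es, ec] at hφ
  obtain ⟨ρ, hρ, hρC⟩ : ∃ ρ : ℝ, 0 < ρ ∧ ∀ t, 0 < t → t < ρ → C ≤ c / 4 * t ^ (α - n) := by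
    have h := (tendsto_rpow_neg_nhdsGT_zero (y := α - n) (by linarith)).const_mul_atTop
      (by positivity : 0 < c / 4)
    obtain ⟨ρ, hρ, h'⟩ := mem_nhdsGT_iff_exists_Ioo_subset.mp (h.eventually_ge_atTop C)
    exact ⟨ρ, hρ, fun t h0 h1 => h' ⟨h0, h1⟩⟩
  set D : ℝ := C * ρ ^ (-α) with hD
  have hD0 : 0 ≤ D := by positivity
  set F : EuclideanSpace ℝ (Fin n) → ℝ := fun x => u x * ‖x‖ ^ (α - n) with hF
  have hF0 : ∀ x, 0 < ‖x‖ → ‖x‖ ≤ 2 * δ → 0 ≤ F x := fun x h0 h1 =>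
    mul_nonneg (hu0 x h0 h1) (by positivity)
  have hCu : ∀ x, 0 < ‖x‖ → ‖x‖ ≤ 2 * δ → C * u x ≤ c / 4 * F x + D := by
    intro x h0 h1
    rcases lt_or_ge ‖x‖ ρ with h | h
    · have := mul_le_mul_of_nonneg_right (hρC _ h0 h) (hu0 x h0 h1)
      simp only [hF]
      linarith
    · have h3 : ‖x‖ ^ (-α) ≤ ρ ^ (-α) := Real.rpow_le_rpow_of_nonpos hρ h (by linarith)
      have := mul_le_mul_of_nonneg_left ((hu1 x h0 h1).trans h3) hC
      have := hF0 x h0 h1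
      nlinarith
  set V := volume.real (ball (0 : EuclideanSpace ℝ (Fin n)) 1) with hV
  set W := volume.real (closedBall (0 : EuclideanSpace ℝ (Fin n)) (2 * δ)) with hW
  refine ⟨4 / c * ((C + c) * 2 ^ n * V + D * W), fun r hr hrδ => ?_⟩
  obtain ⟨φ, φC, φin, φout, φ0, φle, φb, φa⟩ := hφ r hr hrδ
  set K : Set (EuclideanSpace ℝ (Fin n)) := {x | r ≤ ‖x‖ ∧ ‖x‖ ≤ 2 * δ} with hK
  have hKc : IsClosed K := (isClosed_le continuous_const continuous_norm).inter
    (isClosed_le continuous_norm continuous_const)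
  have hKK : IsCompact K :=
    (isCompact_closedBall (0 : EuclideanSpace ℝ (Fin n)) (2 * δ)).of_isClosed_subset hKc
      fun x hx => by simpa using hx.2
  have hKU : K ⊆ ball 0 1 \ {0} := fun x hx => by
    refine ⟨by simpa using hx.2.trans_lt hδ1, ?_⟩
    rintro rfl
    have := hx.1
    simp at this
    linarith
  have hsupp : tsupport φ ⊆ K := by
    refine closure_minimal (fun x hx => ?_) hKc
    by_contra h
    refine hx ?_
    by_cases h1 : ‖x‖ ≤ r
    · exact φin x h1
    · exact φout x (le_of_not_ge fun h2 => h ⟨(not_le.mp h1).le, h2⟩)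
  have hUo : IsOpen (ball (0 : EuclideanSpace ℝ (Fin n)) 1 \ {0}) :=
    isOpen_ball.sdiff isClosed_singleton
  obtain ⟨i1, i2, hint⟩ := hu.integral_mul_bilap hUo φC
    (HasCompactSupport.of_support_subset_isCompact hKK ((subset_tsupport _).trans hsupp))
    (hsupp.trans hKU)
  set A : Set (EuclideanSpace ℝ (Fin n)) := {x | 2 * r < ‖x‖ ∧ ‖x‖ ≤ 2 * δ} with hA
  have hAm : MeasurableSet A := (measurableSet_lt measurable_const measurable_norm).inter
    (measurableSet_le measurable_norm measurable_const)
  have hAK : A ⊆ K := fun x hx => ⟨by linarith [hx.1], hx.2⟩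
  have hFK : ContinuousOn F K := by
    refine (hu.continuousOn.mono hKU).mul (continuous_norm.continuousOn.rpow_const fun x hx => ?_)
    exact Or.inl (hr.trans_le hx.1).ne'
  have hFA : IntegrableOn F A := (hFK.integrableOn_compact hKK).mono_set hAK
  refine ⟨hFA, ?_⟩
  set N : ℝ := r ^ (-(n : ℝ)) with hN
  have hpt : ∀ x, A.indicator (fun x => c / 4 * F x) x ≤ (u x * bilap φ x - bilap u x * φ x)
      + (closedBall 0 (2 * r)).indicator (fun _ => (C + c) * N) x
      + (closedBall 0 (2 * δ)).indicator (fun _ => D) x := by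
    intro x
    have hind1 : 0 ≤ (closedBall 0 (2 * r)).indicator (fun _ => (C + c) * N) x :=
      Set.indicator_nonneg (fun _ _ => by positivity) x
    have hind2 : 0 ≤ (closedBall 0 (2 * δ)).indicator (fun _ => D) x :=
      Set.indicator_nonneg (fun _ _ => hD0) x
    by_cases hxK : x ∈ K
    swap
    · have h1 : φ x = 0 := image_eq_zero_of_notMem_tsupport fun h => hxK (hsupp h)
      have h2 : bilap φ x = 0 := image_eq_zero_of_notMem_tsupport fun h =>
        hxK (hsupp (tsupport_bilap_subset h))
      rw [Set.indicator_of_notMem fun h => hxK (hAK h), h1, h2]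
      linarith
    have hx0 : 0 < ‖x‖ := hr.trans_le hxK.1
    have hxδ : ‖x‖ ≤ 2 * δ := hxK.2
    have ux := hu0 x hx0 hxδ
    have hDi : (closedBall 0 (2 * δ)).indicator (fun _ => D) x = D :=
      Set.indicator_of_mem (by simpa using hxδ) _
    have hup : bilap u x * φ x ≤ c / 2 * F x := by
      calc bilap u x * φ x ≤ (c / 2 * ‖x‖ ^ (-4 : ℝ) * u x) * φ x :=
            mul_le_mul_of_nonneg_right (hu2 x hx0 hxδ) (φ0 x)
        _ ≤ (c / 2 * ‖x‖ ^ (-4 : ℝ) * u x) * ‖x‖ ^ (α + 4 - n) :=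
            mul_le_mul_of_nonneg_left (φle x) (by positivity)
        _ = c / 2 * F x := by
            have : ‖x‖ ^ (α - n) = ‖x‖ ^ (-4 : ℝ) * ‖x‖ ^ (α + 4 - n) := by
              rw [← Real.rpow_add hx0]; congr 1; ring
            simp only [hF, this]; ring
    have hCux := hCu x hx0 hxδ
    rw [hDi]
    by_cases hxr : ‖x‖ ≤ 2 * r
    · rw [Set.indicator_of_notMem fun h : x ∈ A => absurd h.1 (not_lt.mpr hxr),
        Set.indicator_of_mem (by simpa using hxr)]
      have h1 := mul_le_mul_of_nonneg_left (φb x hxr) ux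
      have hru : u x ≤ r ^ (-α) := (hu1 x hx0 hxδ).trans
        (Real.rpow_le_rpow_of_nonpos hr hxK.1 (by linarith))
      have hNe : N = r ^ (-α) * r ^ (α - n) := by
        rw [hN, ← Real.rpow_add hr]; congr 1; ring
      have h2 : u x * (C * r ^ (α - n)) ≤ C * N := by
        have := mul_le_mul_of_nonneg_right hru (by positivity : 0 ≤ C * r ^ (α - n))
        rw [hNe]; linarith
      have h3 : F x ≤ N := by
        rw [hNe]
        exact mul_le_mul hru (Real.rpow_le_rpow_of_nonpos hr hxK.1 (by linarith))
          (by positivity) (by positivity)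
      have h4 := mul_le_mul_of_nonneg_left h3 hcpos.le
      have h5 := mul_nonneg hcpos.le (hF0 x hx0 hxδ)
      linarith
    · have hxA : x ∈ A := ⟨not_le.mp hxr, hxδ⟩
      rw [Set.indicator_of_mem hxA]
      have h1 := mul_le_mul_of_nonneg_left (φa x hxA.1 hxδ) ux
      have h2 : u x * (c * ‖x‖ ^ (α - n) - C) = c * F x - C * u x := by simp only [hF]; ring
      linarith
  have j0 : Integrable (fun x => u x * bilap φ x - bilap u x * φ x) := i1.sub i2
  have j1 : Integrable ((closedBall (0 : EuclideanSpace ℝ (Fin n)) (2 * r)).indicator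
      (fun _ => (C + c) * N)) :=
    (integrable_indicator_iff measurableSet_closedBall).mpr
      (integrableOn_const (measure_closedBall_lt_top.ne))
  have j2 : Integrable ((closedBall (0 : EuclideanSpace ℝ (Fin n)) (2 * δ)).indicator
      (fun _ => D)) :=
    (integrable_indicator_iff measurableSet_closedBall).mpr
      (integrableOn_const (measure_closedBall_lt_top.ne))
  have hmono := integral_mono ((integrable_indicator_iff hAm).mpr (hFA.const_mul (c / 4)))
    ((j0.add j1).add j2) hpt
  simp only [Pi.add_apply] at hmono
  have j01 : Integrable (fun x => u x * bilap φ x - bilap u x * φ x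
      + (closedBall 0 (2 * r)).indicator (fun _ => (C + c) * N) x) := j0.add j1
  rw [integral_add j01 j2, integral_add j0 j1, integral_sub i1 i2, hint, sub_self,
    integral_indicator hAm, integral_indicator measurableSet_closedBall,
    integral_indicator measurableSet_closedBall, setIntegral_const, setIntegral_const,
    integral_const_mul, Measure.addHaar_real_closedBall _ _ (by positivity : 0 ≤ 2 * r)] at hmono
  have hNr : (2 * r) ^ n * N = 2 ^ n := by
    rw [hN, Real.rpow_neg hr.le, Real.rpow_natCast, mul_pow]
    field_simp
  simp only [finrank_euclideanSpace, Fintype.card_fin, smul_eq_mul, zero_add] at hmono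
  rw [div_mul_eq_mul_div, le_div_iff₀ hcpos]
  have h6 : (2 * r) ^ n * V * ((C + c) * N) = (C + c) * 2 ^ n * V := by
    rw [← hNr]; ring
  rw [h6] at hmono
  linarith

open Topology in
/-- Integrability of the weighted function near the origin, for nonnegative functions satisfying a
biharmonic differential inequality with a small Hardy-type potential. -/
lemma integrableOn_mul_norm_rpow {α δ : ℝ} (hα : 0 < α) (hαn : α < n - 4) (hδ : 0 < δ)
    (hδ1 : 2 * δ < 1) {u : EuclideanSpace ℝ (Fin n) → ℝ}
    (hu : ContDiffOn ℝ 4 u (ball 0 1 \ {0}))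
    (hu0 : ∀ x, 0 < ‖x‖ → ‖x‖ ≤ 2 * δ → 0 ≤ u x)
    (hu1 : ∀ x, 0 < ‖x‖ → ‖x‖ ≤ 2 * δ → u x ≤ ‖x‖ ^ (-α))
    (hu2 : ∀ x, 0 < ‖x‖ → ‖x‖ ≤ 2 * δ →
      bilap u x ≤ (n - 4 - α) * (α + 2) * ((n - 2 - α) * α) / 2 * ‖x‖ ^ (-4 : ℝ) * u x) :
    IntegrableOn (fun x => u x * ‖x‖ ^ (α - n)) (closedBall 0 (2 * δ) \ {0}) := by
  obtain ⟨I, hI⟩ := exists_bound_setIntegral_annulus hα hαn hδ hδ1 hu hu0 hu1 hu2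
  have hSm : MeasurableSet (closedBall (0 : EuclideanSpace ℝ (Fin n)) (2 * δ) \ {0}) :=
    measurableSet_closedBall.diff (measurableSet_singleton _)
  let ρ : ℕ → ℝ := fun k => δ / 2 / (k + 1)
  have hρ0 : ∀ k, 0 < ρ k := fun k => by positivity
  have hρδ : ∀ k, 2 * ρ k ≤ δ := fun k => by
    have : ρ k ≤ δ / 2 := div_le_self (by positivity) (by linarith [k.cast_nonneg (α := ℝ)])
    linarith
  have hρt : Tendsto ρ atTop (𝓝 0) := tendsto_const_div_atTop_nhds_zero_nat (δ / 2) |>.comp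
    (tendsto_add_atTop_nat 1) |>.congr fun k => by simp [ρ]
  have hm : ∀ k, MeasurableSet {x : EuclideanSpace ℝ (Fin n) | 2 * ρ k < ‖x‖} := fun k =>
    measurableSet_lt measurable_const measurable_norm
  have hset : ∀ k, {x : EuclideanSpace ℝ (Fin n) | 2 * ρ k < ‖x‖} ∩ (closedBall 0 (2 * δ) \ {0})
      = {x | 2 * ρ k < ‖x‖ ∧ ‖x‖ ≤ 2 * δ} := by
    intro k
    ext x
    simp only [Set.mem_inter_iff, Set.mem_ofPred_eq, Set.mem_sdiff, mem_closedBall_zero_iff,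
      Set.mem_singleton_iff]
    refine ⟨fun h => ⟨h.1, h.2.1⟩, fun h => ⟨h.1, h.2, ?_⟩⟩
    rintro rfl
    have := h.1
    simp at this
    linarith [hρ0 k]
  have hcov : AECover (volume.restrict (closedBall (0 : EuclideanSpace ℝ (Fin n)) (2 * δ) \ {0}))
      atTop (fun k => {x : EuclideanSpace ℝ (Fin n) | 2 * ρ k < ‖x‖}) := by
    refine ⟨?_, hm⟩
    filter_upwards [ae_restrict_mem hSm] with x hx
    have hx0 : 0 < ‖x‖ := norm_pos_iff.mpr hx.2
    have := hρt.const_mul 2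
    rw [mul_zero] at this
    exact this.eventually_lt_const hx0
  refine hcov.integrable_of_integral_norm_bounded I (fun k => ?_) (Eventually.of_forall fun k => ?_)
  · rw [IntegrableOn, Measure.restrict_restrict (hm k), hset]
    exact (hI _ (hρ0 k) (hρδ k)).1
  · rw [Measure.restrict_restrict (hm k), hset]
    refine le_trans (le_of_eq ?_) (hI _ (hρ0 k) (hρδ k)).2
    refine setIntegral_congr_fun ?_ fun x hx => ?_
    · rw [← hset]; exact (hm k).inter hSm
    · exact Real.norm_of_nonneg (mul_nonneg (hu0 x (lt_trans (by linarith [hρ0 k]) hx.1) hx.2)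
        (by positivity))

end Annulus

/-- If `|x|^{4/(p-1)} u(x) → 0` as `x → 0`, then
`∫_{0<|x|≤1/2} u^{(p-1)n/4} < ∞`. -/
theorem stmt_12 (n : ℕ) (hn : 5 ≤ n) (p : ℝ)
    (hp1 : (n : ℝ) / ((n : ℝ) - 4) < p) (hp2 : p < ((n : ℝ) + 4) / ((n : ℝ) - 4))
    (u : EuclideanSpace ℝ (Fin n) → ℝ)
    (hreg : ContDiffOn ℝ 4 u (ball 0 1 \ {0}))
    (hpos : ∀ x ∈ ball (0 : EuclideanSpace ℝ (Fin n)) 1 \ {0}, 0 ≤ u x)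
    (heq : ∀ x ∈ ball (0 : EuclideanSpace ℝ (Fin n)) 1 \ {0}, bilap u x = u x ^ p)
    (hlim : Tendsto (fun x : EuclideanSpace ℝ (Fin n) => ‖x‖ ^ ((4 : ℝ) / (p - 1)) * u x)
      (nhdsWithin 0 {0}ᶜ) (nhds 0)) :
    IntegrableOn (fun x => u x ^ ((p - 1) * (n : ℝ) / 4))
      (closedBall (0 : EuclideanSpace ℝ (Fin n)) (1 / 2) \ {0}) volume := by
  have hn' : (5 : ℝ) ≤ n := by exact_mod_cast hn
  have hn4 : (0 : ℝ) < n - 4 := by linarith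
  have hpn : n < p * (n - 4) := (div_lt_iff₀ hn4).mp hp1
  have hp : 0 < p - 1 := by
    by_contra h
    nlinarith
  set α : ℝ := 4 / (p - 1) with hα
  have hα0 : 0 < α := by positivity
  have hαp : α * (p - 1) = 4 := by rw [hα]; field_simp
  have hαn : α < n - 4 := by
    rw [hα, div_lt_iff₀ hp]; linarith
  set q : ℝ := (p - 1) * n / 4 with hq
  have hαq : α * q = n := by rw [hq, hα]; field_simp
  have hq1 : 1 ≤ q := by
    by_contra h
    nlinarith
  set c : ℝ := (n - 4 - α) * (α + 2) * ((n - 2 - α) * α) with hc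
  have hcpos : 0 < c :=
    mul_pos (mul_pos (by linarith) (by linarith)) (mul_pos (by linarith) hα0)
  set η : ℝ := min 1 ((c / 2) ^ (1 / (p - 1))) with hη
  have hη0 : 0 < η := lt_min one_pos (by positivity)
  have hηc : η ^ (p - 1) ≤ c / 2 := by
    calc η ^ (p - 1) ≤ ((c / 2) ^ (1 / (p - 1))) ^ (p - 1) :=
          Real.rpow_le_rpow hη0.le (min_le_right _ _) hp.le
      _ = c / 2 := by
          rw [← Real.rpow_mul (by positivity), one_div_mul_cancel hp.ne', Real.rpow_one]
  obtain ⟨ε, hε, hεu⟩ : ∃ ε > 0, ∀ x : EuclideanSpace ℝ (Fin n), 0 < ‖x‖ → ‖x‖ < ε →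
      ‖x‖ ^ α * u x < η := by
    have h := hlim.eventually_lt_const hη0
    rw [eventually_nhdsWithin_iff, Metric.eventually_nhds_iff] at h
    obtain ⟨ε, hε, h⟩ := h
    exact ⟨ε, hε, fun x hx hxε => h (by simpa using hxε) (norm_pos_iff.mp hx)⟩
  obtain ⟨δ, hδ, hδε, hδ1⟩ : ∃ δ : ℝ, 0 < δ ∧ 2 * δ < ε ∧ 2 * δ < 1 :=
    ⟨min ε 1 / 4, by positivity, by linarith [min_le_left ε 1, lt_min hε one_pos],
      by linarith [min_le_right ε 1]⟩
  have hmem : ∀ x : EuclideanSpace ℝ (Fin n), 0 < ‖x‖ → ‖x‖ ≤ 2 * δ → x ∈ ball 0 1 \ {0} :=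
    fun x h0 h1 => ⟨by simpa using h1.trans_lt hδ1, norm_pos_iff.mp h0⟩
  have hu0 : ∀ x, 0 < ‖x‖ → ‖x‖ ≤ 2 * δ → 0 ≤ u x := fun x h0 h1 => hpos x (hmem x h0 h1)
  have huη : ∀ x, 0 < ‖x‖ → ‖x‖ ≤ 2 * δ → u x ≤ η * ‖x‖ ^ (-α) := fun x h0 h1 => by
    have h := (hεu x h0 (h1.trans_lt hδε)).le
    rw [Real.rpow_neg h0.le, ← div_eq_mul_inv, le_div_iff₀ (by positivity)]
    linarith
  have hu1 : ∀ x, 0 < ‖x‖ → ‖x‖ ≤ 2 * δ → u x ≤ ‖x‖ ^ (-α) := fun x h0 h1 =>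
    (huη x h0 h1).trans (mul_le_of_le_one_left (by positivity) (min_le_left _ _))
  have hu2 : ∀ x, 0 < ‖x‖ → ‖x‖ ≤ 2 * δ → bilap u x ≤ c / 2 * ‖x‖ ^ (-4 : ℝ) * u x := by
    intro x h0 h1
    have ux := hu0 x h0 h1
    have e : u x ^ p = u x ^ (p - 1) * u x := by
      nth_rewrite 3 [← Real.rpow_one (u x)]
      rw [← Real.rpow_add_of_nonneg ux hp.le zero_le_one, sub_add_cancel]
    rw [heq x (hmem x h0 h1), e]
    refine mul_le_mul_of_nonneg_right ?_ ux
    calc u x ^ (p - 1) ≤ (η * ‖x‖ ^ (-α)) ^ (p - 1) := Real.rpow_le_rpow ux (huη x h0 h1) hp.le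
      _ = η ^ (p - 1) * ‖x‖ ^ (-4 : ℝ) := by
          rw [Real.mul_rpow hη0.le (by positivity), ← Real.rpow_mul h0.le, neg_mul, hαp]
      _ ≤ c / 2 * ‖x‖ ^ (-4 : ℝ) := mul_le_mul_of_nonneg_right hηc (by positivity)
  have hF := integrableOn_mul_norm_rpow hα0 hαn hδ hδ1 hreg hu0 hu1 hu2
  have hcont : ContinuousOn (fun x => u x ^ q) (ball 0 1 \ {0}) :=
    hreg.continuousOn.rpow_const fun x _ => Or.inr (by linarith)
  have hSm : MeasurableSet (closedBall (0 : EuclideanSpace ℝ (Fin n)) (2 * δ) \ {0}) :=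
    measurableSet_closedBall.diff (measurableSet_singleton _)
  have hSU : closedBall (0 : EuclideanSpace ℝ (Fin n)) (2 * δ) \ {0} ⊆ ball 0 1 \ {0} :=
    Set.sdiff_subset_sdiff_left (closedBall_subset_ball hδ1)
  have inner : IntegrableOn (fun x => u x ^ q) (closedBall 0 (2 * δ) \ {0}) := by
    refine hF.mono' ((hcont.mono hSU).aestronglyMeasurable hSm) ?_
    filter_upwards [ae_restrict_mem hSm] with x hx
    have h0 : 0 < ‖x‖ := norm_pos_iff.mpr hx.2
    have h1 : ‖x‖ ≤ 2 * δ := by simpa using hx.1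
    have ux := hu0 x h0 h1
    rw [Real.norm_of_nonneg (by positivity)]
    have e : u x ^ q = u x * u x ^ (q - 1) := by
      nth_rewrite 2 [← Real.rpow_one (u x)]
      rw [← Real.rpow_add_of_nonneg ux zero_le_one (by linarith), add_sub_cancel]
    rw [e]
    refine mul_le_mul_of_nonneg_left ?_ ux
    refine (Real.rpow_le_rpow ux (hu1 x h0 h1) (by linarith)).trans (le_of_eq ?_)
    rw [← Real.rpow_mul h0.le]
    congr 1
    linear_combination -hαq
  have outer : IntegrableOn (fun x => u x ^ q)
      (closedBall (0 : EuclideanSpace ℝ (Fin n)) (1 / 2) \ ball 0 (2 * δ)) := by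
    refine ContinuousOn.integrableOn_compact
      ((isCompact_closedBall _ _).diff isOpen_ball) (hcont.mono fun x hx => ?_)
    refine ⟨closedBall_subset_ball (by norm_num) hx.1, ?_⟩
    rintro rfl
    exact hx.2 (mem_ball_self (by linarith))
  refine (inner.union outer).mono_set fun x hx => ?_
  by_cases h : x ∈ ball (0 : EuclideanSpace ℝ (Fin n)) (2 * δ)
  · exact Or.inl ⟨ball_subset_closedBall h, hx.2⟩
  · exact Or.inr ⟨hx.1, h⟩
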